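/- arXiv:2106.12298 — 3 statements merged into one kernel-verified Lean document; each statement's English description precedes it below -/
import Mathlib

section
/- Let f : ℝ → ℝ be nondecreasing and let a₋ < a₊ be real constants. Let φ₊, φ₋ : [0, ∞) → ℝ be (possibly discontinuous) functions and k : [0, ∞) → [0, ∞) be such that t ↦ k(t) f(φ₊(t)) and t ↦ k(t) f(φ₋(t)) are locally integrable on [0, ∞). Assume that φ₋(t) ≤ a₋ + ∫₀ᵗ k(τ) f(φ₋(τ)) dτ and φ₊(t) ≥ a₊ + ∫₀ᵗ k(τ) f(φ₊(τ)) dτ for all t > 0. Then φ₋(t) < φ₊(t) for all t > 0. -/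
open MeasureTheory

/-- Lemma A.3 (comparison principle for integral inequalities): if `f` is nondecreasing,
`a₋ < a₊`, `k ≥ 0` on `[0,∞)`, the integrands are locally integrable, and
`φ₋(t) ≤ a₋ + ∫₀ᵗ k f(φ₋)` while `φ₊(t) ≥ a₊ + ∫₀ᵗ k f(φ₊)` for all `t > 0`,
then `φ₋(t) < φ₊(t)` for all `t > 0`. -/
theorem comparison_principle_integral_ineq
    (f : ℝ → ℝ) (hf : Monotone f)
    (am ap : ℝ) (ha : am < ap)
    (φp φm k : ℝ → ℝ)
    (hk : ∀ t : ℝ, 0 ≤ t → 0 ≤ k t)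
    (hintm : ∀ T : ℝ, 0 < T → IntegrableOn (fun τ => k τ * f (φm τ)) (Set.Ioc 0 T))
    (hintp : ∀ T : ℝ, 0 < T → IntegrableOn (fun τ => k τ * f (φp τ)) (Set.Ioc 0 T))
    (hm : ∀ t : ℝ, 0 < t → φm t ≤ am + ∫ τ in Set.Ioc (0:ℝ) t, k τ * f (φm τ))
    (hp : ∀ t : ℝ, 0 < t → ap + ∫ τ in Set.Ioc (0:ℝ) t, k τ * f (φp τ) ≤ φp t) :
    ∀ t : ℝ, 0 < t → φm t < φp t := by
  intro T hT
  set h : ℝ → ℝ := fun τ => k τ * f (φp τ) - k τ * f (φm τ) with hh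
  have hint : ∀ t, 0 < t → IntegrableOn h (Set.Ioc 0 t) := fun t ht =>
    (hintp t ht).sub (hintm t ht)
  have hle : ∀ t, 0 < t → ap - am + ∫ τ in Set.Ioc (0:ℝ) t, h τ ≤ φp t - φm t := by
    intro t ht
    have := integral_sub (hintp t ht) (hintm t ht)
    simp only [hh]
    linarith [hm t ht, hp t ht]
  suffices hpos : ∀ t ∈ Set.Icc 0 T, 0 < ap - am + ∫ τ in Set.Ioc (0:ℝ) t, h τ by
    linarith [hle T hT, hpos T ⟨hT.le, le_rfl⟩]
  by_contra! hneg
  have hcont : ContinuousOn (fun t => ap - am + ∫ τ in Set.Ioc (0:ℝ) t, h τ) (Set.Icc 0 T) :=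
    continuousOn_const.add (intervalIntegral.continuousOn_primitive
      (Iff.mpr integrableOn_Icc_iff_integrableOn_Ioc (hint T hT)))
  have hcompact : IsCompact
      (Set.Icc 0 T ∩ (fun t => ap - am + ∫ τ in Set.Ioc (0:ℝ) t, h τ) ⁻¹' Set.Iic 0) :=
    isCompact_Icc.of_isClosed_subset (hcont.preimage_isClosed_of_isClosed isClosed_Icc isClosed_Iic)
      Set.inter_subset_left
  obtain ⟨t₁, ht₁, ht₁'⟩ := hneg
  obtain ⟨t₀, ⟨ht₀, hG⟩, hmin⟩ := hcompact.exists_isLeast ⟨t₁, ht₁, ht₁'⟩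
  have hnonneg : 0 ≤ ∫ τ in Set.Ioc (0:ℝ) t₀, h τ := by
    rw [integral_Ioc_eq_integral_Ioo]
    refine setIntegral_nonneg measurableSet_Ioo fun τ hτ => ?_
    have hGτ : 0 < ap - am + ∫ s in Set.Ioc (0:ℝ) τ, h s := by
      by_contra! hcon
      exact (hmin ⟨⟨hτ.1.le, hτ.2.le.trans ht₀.2⟩, hcon⟩).not_gt hτ.2
    have hlt : φm τ ≤ φp τ := by linarith [hle τ hτ.1]
    exact sub_nonneg.mpr (mul_le_mul_of_nonneg_left (hf hlt) (hk τ hτ.1.le))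
  have hG' : ap - am + ∫ τ in Set.Ioc (0:ℝ) t₀, h τ ≤ 0 := hG
  linarith
end

section
/- Let N ≥ 1 be an integer, d > 0, κ = 2 + N d, C₅ > 0, a > 0 and T > 0. Let ψ : (0, T) → [0, ∞) be such that τ ↦ τ^{1/κ − 1} ψ(τ)^{1 + d/κ} is integrable on (0, t) for every t ∈ (0, T), and assume ψ(t) ≤ a + C₅ ∫₀ᵗ τ^{1/κ − 1} ψ(τ)^{1 + d/κ} dτ for all t ∈ (0, T). Then for every t ∈ (0, T) with a^{−d/κ} − C₅ d t^{1/κ} > 0, one has ψ(t) ≤ (a^{−d/κ} − C₅ d t^{1/κ})^{−κ/d}. -/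
open MeasureTheory

/-- The convexity inequality `x ^ (-p) - p * x ^ (-p - 1) * (y - x) ≤ y ^ (-p)`, multiplied out. -/
theorem rpow_neg_sub_rpow_neg_le {p x y : ℝ} (hp : 0 ≤ p) (hx : 0 < x) (hy : 0 < y) :
    x ^ (-p) - y ^ (-p) ≤ p * ((y - x) / x ^ (1 + p)) := by
  have h1 : 1 - p * (y / x - 1) ≤ (y / x) ^ (-p) := by
    have hq : 0 < y / x := div_pos hy hx
    rw [Real.rpow_def_of_pos hq]
    have h2 := Real.add_one_le_exp (Real.log (y / x) * (-p))
    have h3 := mul_le_mul_of_nonneg_left (Real.log_le_sub_one_of_pos hq) hp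
    linarith
  rw [Real.div_rpow hy.le hx.le, le_div_iff₀ (Real.rpow_pos_of_pos hx _)] at h1
  have h4 : p * ((y - x) / x ^ (1 + p)) = p * (y / x - 1) * x ^ (-p) := by
    rw [Real.rpow_neg hx.le, Real.rpow_add hx, Real.rpow_one]
    have := (Real.rpow_pos_of_pos hx p).ne'
    field_simp
  rw [h4]
  linarith

/-- Comparison of a positive continuous function whose increments satisfy
`Φ z - Φ x ≤ K * Φ z ^ (1 + p) * (z - x)` with the solution of `y' = K * y ^ (1 + p)`. -/
theorem rpow_neg_sub_le_of_increment_le {Φ : ℝ → ℝ} {p K b : ℝ} (hp : 0 ≤ p) (hb : 0 ≤ b)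
    (hΦc : ContinuousOn Φ (Set.Icc 0 b)) (hΦpos : ∀ x ∈ Set.Icc 0 b, 0 < Φ x)
    (hinc : ∀ x ∈ Set.Icc 0 b, ∀ z ∈ Set.Icc 0 b, x ≤ z →
      Φ z - Φ x ≤ K * Φ z ^ (1 + p) * (z - x)) :
    Φ 0 ^ (-p) - p * K * b ≤ Φ b ^ (-p) := by
  have key := image_le_of_liminf_slope_right_le_deriv_boundary
    (f := fun x => -Φ x ^ (-p)) (a := 0) (b := b)
    (B := fun x => -Φ 0 ^ (-p) + p * K * x) (B' := fun _ => p * K)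
    ((hΦc.rpow_const fun x hx => Or.inl (hΦpos x hx).ne').neg) (by simp) (by fun_prop)
    (fun x _ => by
      simpa using (((hasDerivAt_id x).const_mul (p * K)).const_add
        (-Φ 0 ^ (-p))).hasDerivWithinAt)
    (by
      intro x hx r hr
      have hxI : x ∈ Set.Icc 0 b := Set.Ico_subset_Icc_self hx
      have hxpos := hΦpos x hxI
      have hnhds : Set.Icc 0 b ∈ nhdsWithin x (Set.Ioi x) :=
        Filter.mem_of_superset (Ioo_mem_nhdsGT hx.2)
          fun z hz => ⟨hx.1.trans hz.1.le, hz.2.le⟩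
      have hcont : Filter.Tendsto Φ (nhdsWithin x (Set.Ioi x)) (nhds (Φ x)) :=
        (hΦc x hxI).mono_left (nhdsWithin_le_of_mem hnhds)
      have hlim : Filter.Tendsto (fun z => p * (K * Φ z ^ (1 + p) / Φ x ^ (1 + p)))
          (nhdsWithin x (Set.Ioi x)) (nhds (p * (K * Φ x ^ (1 + p) / Φ x ^ (1 + p)))) :=
        (((hcont.rpow_const (Or.inl hxpos.ne')).const_mul K).div_const _).const_mul p
      rw [mul_div_cancel_right₀ _ (Real.rpow_pos_of_pos hxpos _).ne'] at hlim
      refine Filter.Eventually.frequently ?_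
      filter_upwards [hlim.eventually_lt_const hr, hnhds, self_mem_nhdsWithin]
        with z hz hzI hxz
      refine lt_of_le_of_lt ?_ hz
      have hxz' : 0 < z - x := sub_pos.2 hxz
      rw [slope_def_field, div_le_iff₀ hxz']
      calc -Φ z ^ (-p) - -Φ x ^ (-p) = Φ x ^ (-p) - Φ z ^ (-p) := by ring
        _ ≤ p * ((Φ z - Φ x) / Φ x ^ (1 + p)) :=
          rpow_neg_sub_rpow_neg_le hp hxpos (hΦpos z hzI)
        _ ≤ p * ((K * Φ z ^ (1 + p) * (z - x)) / Φ x ^ (1 + p)) := by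
          have := Real.rpow_pos_of_pos hxpos (1 + p)
          gcongr
          exact hinc x hxI z hzI (le_of_lt hxz)
        _ = p * (K * Φ z ^ (1 + p) / Φ x ^ (1 + p)) * (z - x) := by ring)
    (Set.right_mem_Icc.2 hb)
  linarith

/-- Gronwall-type bound for `ψ t ≤ a + C * ∫ τ in 0..t, τ ^ (q - 1) * ψ τ ^ (1 + p)`. -/
theorem rpow_neg_sub_le_of_integral_inequality {ψ : ℝ → ℝ} {p q a C b : ℝ} (hp : 0 ≤ p)
    (hq : 0 < q) (ha : 0 < a) (hC : 0 ≤ C) (hb : 0 ≤ b) (hψ0 : ∀ t ∈ Set.Ioc 0 b, 0 ≤ ψ t)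
    (hint : IntervalIntegrable (fun τ => τ ^ (q - 1) * ψ τ ^ (1 + p)) volume 0 b)
    (hineq : ∀ t ∈ Set.Ioc 0 b, ψ t ≤ a + C * ∫ τ in 0..t, τ ^ (q - 1) * ψ τ ^ (1 + p)) :
    a ^ (-p) - p * (C / q) * b ^ q ≤
      (a + C * ∫ τ in 0..b, τ ^ (q - 1) * ψ τ ^ (1 + p)) ^ (-p) := by
  set F : ℝ → ℝ := fun τ => τ ^ (q - 1) * ψ τ ^ (1 + p) with hF
  set Φ : ℝ → ℝ := fun t => a + C * ∫ τ in 0..t, F τ with hΦ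
  have hF0 : ∀ τ ∈ Set.Ioc 0 b, 0 ≤ F τ := fun τ hτ =>
    mul_nonneg (Real.rpow_nonneg hτ.1.le _) (Real.rpow_nonneg (hψ0 τ hτ) _)
  have hintsub : ∀ s ∈ Set.Icc 0 b, ∀ t ∈ Set.Icc 0 b, IntervalIntegrable F volume s t := by
    intro s hs t ht
    refine hint.mono_set ?_
    rw [Set.uIcc_of_le hb]
    exact Set.uIcc_subset_Icc hs ht
  have h0 : (0 : ℝ) ∈ Set.Icc 0 b := Set.left_mem_Icc.2 hb
  have hdiff : ∀ s ∈ Set.Icc 0 b, ∀ t ∈ Set.Icc 0 b, Φ t - Φ s = C * ∫ τ in s..t, F τ := by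
    intro s hs t ht
    rw [← intervalIntegral.integral_interval_sub_left (hintsub 0 h0 t ht) (hintsub 0 h0 s hs)]
    simp only [hΦ]
    ring
  have hmono : ∀ s ∈ Set.Icc 0 b, ∀ t ∈ Set.Icc 0 b, s ≤ t → Φ s ≤ Φ t := by
    intro s hs t ht hst
    rw [← sub_nonneg, hdiff s hs t ht, intervalIntegral.integral_of_le hst]
    exact mul_nonneg hC (setIntegral_nonneg measurableSet_Ioc
      fun τ hτ => hF0 τ ⟨hs.1.trans_lt hτ.1, hτ.2.trans ht.2⟩)
  have hΦ0 : Φ 0 = a := by simp [hΦ]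
  have hpos : ∀ t ∈ Set.Icc 0 b, 0 < Φ t := fun t ht =>
    ha.trans_le (hΦ0 ▸ hmono 0 h0 t ht ht.1)
  have hcont : ContinuousOn Φ (Set.Icc 0 b) := by
    have := intervalIntegral.continuousOn_primitive_interval' hint Set.left_mem_uIcc
    rw [Set.uIcc_of_le hb] at this
    exact (this.const_mul C).const_add a
  have hinc : ∀ s ∈ Set.Icc 0 b, ∀ t ∈ Set.Icc 0 b, s ≤ t →
      Φ t - Φ s ≤ C / q * Φ t ^ (1 + p) * (t ^ q - s ^ q) := by
    intro s hs t ht hst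
    have hle : ∫ τ in s..t, F τ ≤ ∫ τ in s..t, τ ^ (q - 1) * Φ t ^ (1 + p) := by
      refine intervalIntegral.integral_mono_on_of_le_Ioo hst (hintsub s hs t ht)
        ((intervalIntegral.intervalIntegrable_rpow' (by linarith)).mul_const _) ?_
      intro τ hτ
      have hτb : τ ∈ Set.Ioc 0 b := ⟨hs.1.trans_lt hτ.1, hτ.2.le.trans ht.2⟩
      refine mul_le_mul_of_nonneg_left ?_ (Real.rpow_nonneg hτb.1.le _)
      refine Real.rpow_le_rpow (hψ0 τ hτb) ?_ (by linarith)
      exact (hineq τ hτb).trans (hmono τ (Set.Ioc_subset_Icc_self hτb) t ht hτ.2.le)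
    rw [intervalIntegral.integral_mul_const, integral_rpow (Or.inl (by linarith)),
      sub_add_cancel] at hle
    rw [hdiff s hs t ht]
    calc C * ∫ τ in s..t, F τ ≤ C * ((t ^ q - s ^ q) / q * Φ t ^ (1 + p)) := by gcongr
      _ = _ := by ring
  have hmaps : ∀ u ∈ Set.Icc 0 (b ^ q), u ^ q⁻¹ ∈ Set.Icc 0 b := fun u hu =>
    ⟨Real.rpow_nonneg hu.1 _, (Real.rpow_inv_le_iff_of_pos hu.1 hb hq).2 hu.2⟩
  have key := rpow_neg_sub_le_of_increment_le (Φ := fun u => Φ (u ^ q⁻¹)) (K := C / q)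
    hp (Real.rpow_nonneg hb q)
    (hcont.comp (Real.continuous_rpow_const (inv_nonneg.2 hq.le)).continuousOn hmaps)
    (fun u hu => hpos _ (hmaps u hu))
    (by
      intro x hx z hz hxz
      have := hinc _ (hmaps x hx) _ (hmaps z hz)
        (Real.rpow_le_rpow hx.1 hxz (inv_nonneg.2 hq.le))
      rwa [Real.rpow_inv_rpow hx.1 hq.ne', Real.rpow_inv_rpow hz.1 hq.ne'] at this)
  simpa only [Real.zero_rpow (inv_ne_zero hq.ne'), hΦ0, Real.rpow_rpow_inv hb hq.ne'] using key

/-- Nonlinear Gronwall-type majorization (proof of Lemma 4.6): if `κ = 2 + Nd` and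
`ψ ≥ 0` satisfies `ψ(t) ≤ a + C₅ ∫₀ᵗ τ^{1/κ−1} ψ(τ)^{1+d/κ} dτ` on `(0,T)`, then
`ψ(t) ≤ (a^{−d/κ} − C₅ d t^{1/κ})^{−κ/d}` whenever the base is positive. -/
theorem gronwall_majorization_psi
    (N : ℕ) (hN : 1 ≤ N) (d : ℝ) (hd : 0 < d)
    (κ : ℝ) (hκ : κ = 2 + (N : ℝ) * d)
    (C₅ a T : ℝ) (hC₅ : 0 < C₅) (ha : 0 < a) (hT : 0 < T)
    (ψ : ℝ → ℝ)
    (hψ0 : ∀ t ∈ Set.Ioo (0:ℝ) T, 0 ≤ ψ t)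
    (hint : ∀ t ∈ Set.Ioo (0:ℝ) T,
      IntegrableOn (fun τ => τ ^ (1 / κ - 1) * ψ τ ^ (1 + d / κ)) (Set.Ioc 0 t))
    (hineq : ∀ t ∈ Set.Ioo (0:ℝ) T,
      ψ t ≤ a + C₅ * ∫ τ in Set.Ioc (0:ℝ) t, τ ^ (1 / κ - 1) * ψ τ ^ (1 + d / κ)) :
    ∀ t ∈ Set.Ioo (0:ℝ) T, 0 < a ^ (-d / κ) - C₅ * d * t ^ (1 / κ) →
      ψ t ≤ (a ^ (-d / κ) - C₅ * d * t ^ (1 / κ)) ^ (-κ / d) := by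
  intro t ht hbase
  have hκ0 : 0 < κ := by
    rw [hκ]
    positivity
  have hIoc : ∀ s ∈ Set.Ioc 0 t, s ∈ Set.Ioo 0 T := fun s hs => ⟨hs.1, hs.2.trans_lt ht.2⟩
  have hbound := rpow_neg_sub_le_of_integral_inequality (p := d / κ) (q := 1 / κ)
    (div_pos hd hκ0).le (one_div_pos.2 hκ0) ha hC₅.le ht.1.le
    (fun s hs => hψ0 s (hIoc s hs))
    ((intervalIntegrable_iff_integrableOn_Ioc_of_le ht.1.le).2 (hint t ht))
    (fun s hs => by
      rw [intervalIntegral.integral_of_le hs.1.le]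
      exact hineq s (hIoc s hs))
  rw [intervalIntegral.integral_of_le ht.1.le, ← neg_div,
    show d / κ * (C₅ / (1 / κ)) = C₅ * d by field_simp] at hbound
  refine (hineq t ht).trans ?_
  set y := a + C₅ * ∫ τ in Set.Ioc (0:ℝ) t, τ ^ (1 / κ - 1) * ψ τ ^ (1 + d / κ) with hy
  have hy0 : 0 ≤ y := add_nonneg ha.le (mul_nonneg hC₅.le
    (setIntegral_nonneg measurableSet_Ioc fun τ hτ =>
      mul_nonneg (Real.rpow_nonneg hτ.1.le _) (Real.rpow_nonneg (hψ0 τ (hIoc τ hτ)) _)))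
  calc y = (y ^ (-d / κ)) ^ (-κ / d) := by
        rw [← Real.rpow_mul hy0, show -d / κ * (-κ / d) = 1 by field_simp, Real.rpow_one]
    _ ≤ _ := Real.rpow_le_rpow_of_nonpos hbase hbound
        (div_nonpos_of_nonpos_of_nonneg (by linarith) hd.le)
end

section
/- Let (Z_n)_{n≥0} be a bounded sequence of nonnegative real numbers, let a ≥ 0, C ≥ 0, b ≥ 1 and ν ∈ (0, 1) with ν b < 1, and suppose Z_n ≤ a + ν Z_{n+1} + C bⁿ for all n ≥ 0. Then Z₀ ≤ a/(1−ν) + C/(1−νb). -/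
/-- A real sequence with `W n ≤ ν * W (n + 1)` satisfies `W 0 ≤ ν ^ n * W n`. -/
theorem apply_zero_le_pow_mul_of_le_mul_succ {W : ℕ → ℝ} {ν : ℝ} (hν : 0 ≤ ν)
    (hW : ∀ n, W n ≤ ν * W (n + 1)) (n : ℕ) : W 0 ≤ ν ^ n * W n := by
  induction n with
  | zero => simp
  | succ n ih =>
    calc W 0 ≤ ν ^ n * W n := ih
      _ ≤ ν ^ n * (ν * W (n + 1)) := by gcongr; exact hW n
      _ = ν ^ (n + 1) * W (n + 1) := by ring

/-- A real sequence that is bounded above and satisfies `W n ≤ ν * W (n + 1)` with `0 ≤ ν < 1`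
starts at a nonpositive value. -/
theorem nonpos_of_le_mul_succ_of_bddAbove {W : ℕ → ℝ} {ν : ℝ} (hν : 0 ≤ ν) (hν1 : ν < 1)
    (hbdd : BddAbove (Set.range W)) (hW : ∀ n, W n ≤ ν * W (n + 1)) : W 0 ≤ 0 := by
  obtain ⟨M, hM⟩ := hbdd
  have hlim : Filter.Tendsto (fun n : ℕ => ν ^ n * M) Filter.atTop (nhds 0) := by
    simpa using (tendsto_pow_atTop_nhds_zero_of_lt_one hν hν1).mul_const M
  refine ge_of_tendsto' hlim fun n => (apply_zero_le_pow_mul_of_le_mul_succ hν hW n).trans ?_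
  gcongr
  exact hM ⟨n, rfl⟩

/-- Absorption/iteration lemma (used in Lemmas 3.2–3.4): if `(Zₙ)` is a bounded
sequence of nonnegative reals with `Zₙ ≤ a + ν Z_{n+1} + C bⁿ`, where `a, C ≥ 0`,
`b ≥ 1`, `ν ∈ (0,1)` and `ν b < 1`, then `Z₀ ≤ a/(1−ν) + C/(1−νb)`. -/
theorem absorption_iteration
    (Z : ℕ → ℝ) (hZnonneg : ∀ n, 0 ≤ Z n) (hZbdd : BddAbove (Set.range Z))
    (a C b ν : ℝ) (ha : 0 ≤ a) (hC : 0 ≤ C) (hb : 1 ≤ b)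
    (hν : ν ∈ Set.Ioo (0:ℝ) 1) (hνb : ν * b < 1)
    (hrec : ∀ n : ℕ, Z n ≤ a + ν * Z (n + 1) + C * b ^ n) :
    Z 0 ≤ a / (1 - ν) + C / (1 - ν * b) := by
  obtain ⟨hν0, hν1⟩ := hν
  have h1 : 0 < 1 - ν := sub_pos.2 hν1
  have h2 : 0 < 1 - ν * b := sub_pos.2 hνb
  set S := a / (1 - ν)
  set T := C / (1 - ν * b)
  have hS0 : 0 ≤ S := by positivity
  have hT0 : 0 ≤ T := by positivity
  have hSa : S * (1 - ν) = a := div_mul_cancel₀ a h1.ne'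
  have hTC : T * (1 - ν * b) = C := div_mul_cancel₀ C h2.ne'
  have hbdd : BddAbove (Set.range fun n => Z n - S - T * b ^ n) := by
    obtain ⟨M, hM⟩ := hZbdd
    refine ⟨M, ?_⟩
    rintro _ ⟨n, rfl⟩
    have hn : Z n ≤ M := hM ⟨n, rfl⟩
    have hTb : 0 ≤ T * b ^ n := by positivity
    dsimp only
    linarith
  have hW0 := nonpos_of_le_mul_succ_of_bddAbove hν0.le hν1 hbdd fun n => by
    have hn := hrec n
    rw [← hSa, ← hTC] at hn
    rw [pow_succ]
    linarith
  simp only [pow_zero, mul_one] at hW0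
  linarith
end
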